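/- Let f : X → S be a smooth morphism of finite-type schemes over a noetherian base with X = Spec A affine, t ∈ A a regular element such that D = V(t) is irreducible and smooth over S, and let U = Spec A[t^{-1}]. For g ∈ A[t^{-1}] and n ≥ 0, the set Pol_{≤n}(g) of points s ∈ S such that the restriction g|_{U_s} has pole order at most n along the divisor D_s ⊆ X_s is a constructible subset of S. -/

import Mathlib

open TensorProduct

noncomputable section

universe u

variable (R : Type u) [CommRing R] (A : Type u) [CommRing A] [Algebra R A] (t : A)

/-- The residue field `κ(q)` of a point `q ∈ Spec R`. -/
abbrev residueFieldAt (q : PrimeSpectrum R) : Type u :=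
  IsLocalRing.ResidueField (Localization.AtPrime q.asIdeal)

/-- The fiber `X_s = Spec (A ⊗_R κ(q))` of `X = Spec A` over `q ∈ Spec R`. -/
abbrev fiberRing (q : PrimeSpectrum R) : Type u := A ⊗[R] residueFieldAt R q

/-- The fiber `U_s = Spec (A[t⁻¹] ⊗_R κ(q))` of `U = Spec A[t⁻¹]` over `q`. -/
abbrev fiberRingAway (q : PrimeSpectrum R) : Type u :=
  (Localization.Away t) ⊗[R] residueFieldAt R q

/-- The localization map `A ⊗ κ(q) → A[t⁻¹] ⊗ κ(q)` between the fibers. -/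
def fiberMap (q : PrimeSpectrum R) : fiberRing R A q →ₐ[R] fiberRingAway R A t q :=
  Algebra.TensorProduct.map (IsScalarTower.toAlgHom R A (Localization.Away t))
    (AlgHom.id R (residueFieldAt R q))

/-- `Pol_{≤n}(g)`: the set of points `q ∈ S = Spec R` such that `g` restricted
to the fiber `U_q` has pole order at most `n` along the divisor `D_q`, i.e.
such that `t^n·g` lies in the image of the local ring of the fiber `X_q` at
every point of `D_q`. -/
def polLE (g : Localization.Away t) (n : ℕ) : Set (PrimeSpectrum R) :=
  {q | ∀ P : PrimeSpectrum (fiberRing R A q),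
    (t ⊗ₜ[R] (1 : residueFieldAt R q)) ∈ P.asIdeal →
    ∃ a u : fiberRing R A q, u ∉ P.asIdeal ∧
      fiberMap R A t q u *
          ((algebraMap A (Localization.Away t) t ^ n * g) ⊗ₜ[R]
            (1 : residueFieldAt R q))
        = fiberMap R A t q a}

/-- A set is constructible if it is a finite union of locally closed sets. -/
def IsConstructibleSet {α : Type*} [TopologicalSpace α] (C : Set α) : Prop :=
  ∃ (m : ℕ) (U Z : Fin m → Set α),
    (∀ i, IsOpen (U i)) ∧ (∀ i, IsClosed (Z i)) ∧ C = ⋃ i, U i ∩ Z i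

section ConstructibleSets

open scoped Topology

variable {S : Type*} [CommRing S]

lemma PrimeSpectrum.isConstructibleSet_of_isConstructible {C : Set (PrimeSpectrum S)}
    (hC : Topology.IsConstructible C) : IsConstructibleSet C := by
  obtain ⟨D, rfl⟩ := PrimeSpectrum.exists_constructibleSetData_iff.mpr hC
  refine ⟨D.card, fun i ↦ (zeroLocus {(D.equivFin.symm i).1.f})ᶜ,
    fun i ↦ zeroLocus (Set.range (D.equivFin.symm i).1.g),
    fun i ↦ (isClosed_zeroLocus _).isOpen_compl, fun i ↦ isClosed_zeroLocus _, ?_⟩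
  ext x
  simp only [ConstructibleSetData.toSet, BasicConstructibleSetData.toSet, Set.mem_iUnion,
    Set.mem_sdiff, Set.mem_inter_iff, Set.mem_compl_iff]
  constructor
  · rintro ⟨c, hc, h₁, h₂⟩
    exact ⟨D.equivFin ⟨c, hc⟩, by rwa [Equiv.symm_apply_apply], by rwa [Equiv.symm_apply_apply]⟩
  · rintro ⟨i, h₁, h₂⟩
    exact ⟨_, (D.equivFin.symm i).2, h₂, h₁⟩

lemma PrimeSpectrum.isOpen_withConstructibleTopology {C : Set (PrimeSpectrum S)}
    (hC : Topology.IsConstructible C) :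
    IsOpen (WithTopology.ofTopology ⁻¹' C : Set (WithConstructibleTopology (PrimeSpectrum S))) := by
  obtain ⟨D, rfl⟩ := PrimeSpectrum.exists_constructibleSetData_iff.mpr hC
  simp only [ConstructibleSetData.toSet, Set.preimage_iUnion]
  refine isOpen_biUnion fun c _ ↦ IsOpen.inter ?_ ?_
  · refine WithConstructibleTopology.isOpen_iff.mpr
      (IsCompact.isOpen_constructibleTopology_of_isClosed ?_ (isClosed_zeroLocus _))
    exact (PrimeSpectrum.isRetrocompact_zeroLocus_compl (Set.finite_range _)).isCompact
  · refine WithConstructibleTopology.isOpen_iff.mpr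
      (IsCompact.isOpen_constructibleTopology_of_isOpen ?_ (isClosed_zeroLocus _).isOpen_compl)
    exact (PrimeSpectrum.isRetrocompact_zeroLocus_compl (Set.finite_singleton _)).isCompact

/-- A set is constructible if it and its complement are unions of constructible sets. -/
lemma PrimeSpectrum.isConstructible_of_forall_exists {Z : Set (PrimeSpectrum S)}
    (h : ∀ q, ∃ W, Topology.IsConstructible W ∧ q ∈ W ∧ (q ∈ Z → W ⊆ Z) ∧ (q ∉ Z → W ⊆ Zᶜ)) :
    Topology.IsConstructible Z := by
  choose W hW hqW hZ hZc using h
  have : ∃ s : Finset (PrimeSpectrum S), ⋃ q ∈ s, W q = Set.univ := by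
    let e : WithConstructibleTopology (PrimeSpectrum S) → PrimeSpectrum S :=
      WithTopology.ofTopology
    obtain ⟨s, hs⟩ := isCompact_univ.elim_finite_subcover (fun q ↦ e ⁻¹' W q)
      (fun q ↦ isOpen_withConstructibleTopology (hW q))
      (fun x _ ↦ Set.mem_iUnion.mpr ⟨e x, hqW _⟩)
    refine ⟨s, Set.eq_univ_of_forall fun q ↦ ?_⟩
    simpa [e] using hs (Set.mem_univ (WithTopology.toTopology _ q))
  obtain ⟨s, hs⟩ := this
  have : Z = ⋃ q ∈ {q ∈ (s : Set (PrimeSpectrum S)) | q ∈ Z}, W q := by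
    refine subset_antisymm (fun x hx ↦ ?_) (Set.iUnion₂_subset fun q hq ↦ hZ q hq.2)
    obtain ⟨q, hq, hxq⟩ := Set.mem_iUnion₂.mp (hs.ge (Set.mem_univ x))
    refine Set.mem_iUnion₂.mpr ⟨q, ⟨hq, ?_⟩, hxq⟩
    by_contra hqZ
    exact hZc q hqZ hxq hx
  rw [this]
  exact .biUnion (s.finite_toSet.subset fun _ h ↦ h.1) fun q _ ↦ hW q

end ConstructibleSets

section Vanishing

variable {S T M : Type*} [CommRing S] [CommRing T] [Algebra S T] [AddCommGroup M] [Module S M]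

/-- The embedding of residue fields induced by an algebra map, at a point of its target. -/
def residueFieldComap (p : PrimeSpectrum T) :
    (p.comap (algebraMap S T)).asIdeal.ResidueField →ₐ[S] p.asIdeal.ResidueField :=
  Ideal.ResidueField.mapₐ _ _ (Algebra.ofId S T) rfl

lemma tmul_one_residueField_ne_zero (φ : M →ₗ[S] T) {b : M} {p : PrimeSpectrum T}
    (hp : φ b ∉ p.asIdeal) :
    b ⊗ₜ[S] (1 : (p.comap (algebraMap S T)).asIdeal.ResidueField) ≠ 0 := by
  intro h
  let ρ : T →ₗ[S] p.asIdeal.ResidueField := (IsScalarTower.toAlgHom S T _).toLinearMap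
  have := congr(LinearMap.mul' S p.asIdeal.ResidueField
    (TensorProduct.map (ρ ∘ₗ φ) (residueFieldComap p).toLinearMap $h))
  simp only [map_tmul, LinearMap.mul'_apply, map_zero, AlgHom.toLinearMap_apply, map_one,
    mul_one] at this
  exact hp (Ideal.algebraMap_residueField_eq_zero.mp this)

lemma tmul_one_eq_zero_of_algHom {k L : Type*} [Field k] [CommRing L] [Nontrivial L] [Algebra S k]
    [Algebra S L] (i : k →ₐ[S] L) {b : M} (h : b ⊗ₜ[S] (1 : L) = 0) : b ⊗ₜ[S] (1 : k) = 0 := by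
  let _ : Algebra k L := i.toRingHom.toAlgebra
  have : IsScalarTower S k L := .of_algebraMap_eq' i.comp_algebraMap.symm
  obtain ⟨r, hr⟩ := (Algebra.linearMap k L).exists_leftInverse_of_injective
    (LinearMap.ker_eq_bot.mpr (FaithfulSMul.algebraMap_injective k L))
  have hr1 : r 1 = 1 := by simpa using congr($hr 1)
  simpa [hr1] using congr((r.restrictScalars S).lTensor M $h)

lemma tmul_one_residueField_eq_zero {b : M} (h : (1 : T) ⊗ₜ[S] b = 0) (p : PrimeSpectrum T) :
    b ⊗ₜ[S] (1 : (p.comap (algebraMap S T)).asIdeal.ResidueField) = 0 := by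
  refine tmul_one_eq_zero_of_algHom (residueFieldComap p) ?_
  simpa using congr(TensorProduct.comm S _ _
    ((IsScalarTower.toAlgHom S T p.asIdeal.ResidueField).toLinearMap.rTensor M $h))

end Vanishing

section Matrices

variable {K C : Type*} [Field K] [CommRing C] [Algebra K C]

lemma Ideal.finite_quotient_pow_of_isMaximal [Algebra.FiniteType K C] (m : Ideal C)
    [hm : m.IsMaximal] (k : ℕ) : Module.Finite K (C ⧸ m ^ k) := by
  rw [Module.finite_iff_krullDimLE_zero, Ring.krullDimLE_zero_iff]
  intro P hP
  have hmk := Ideal.Quotient.mk_surjective (I := m ^ k)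
  have : m ^ k ≤ P.comap (Ideal.Quotient.mk (m ^ k)) := fun x hx ↦ by
    simp [Ideal.mem_comap, Ideal.Quotient.eq_zero_iff_mem.mpr hx]
  have h := hm.eq_of_le (Ideal.comap_isPrime _ P).ne_top (Ideal.IsPrime.le_of_pow_le this)
  have hle : m ^ k ≤ m := this.trans h.ge
  rw [← Ideal.map_comap_of_surjective _ hmk P, ← h]
  exact hm.map_of_surjective_of_ker_le hmk (Ideal.mk_ker.le.trans hle)

/-- A nonzero element of a finite type algebra over a field acts nontrivially in some finite
dimensional representation. -/
lemma Algebra.FiniteType.exists_matrix_ne_zero [Algebra.FiniteType K C] {b : C} (hb : b ≠ 0) :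
    ∃ (r : ℕ) (ψ : C →ₐ[K] Matrix (Fin r) (Fin r) K), ψ b ≠ 0 := by
  have : IsNoetherianRing C := Algebra.FiniteType.isNoetherianRing K C
  obtain ⟨m, hm, hle⟩ := Ideal.exists_le_maximal (Ideal.span {b}).annihilator (by
    rw [Ne, Ideal.eq_top_iff_one, Submodule.mem_annihilator_span_singleton]
    simpa using hb)
  obtain ⟨k, hk⟩ : ∃ k, b ∉ m ^ k := by
    by_contra! h
    obtain ⟨⟨r, hr⟩, hrb⟩ := (m.mem_iInf_smul_pow_eq_bot_iff b).mp (by simpa using h)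
    refine hm.ne_top (m.eq_top_iff_one.mpr ?_)
    have : 1 - r ∈ m := hle ((Submodule.mem_annihilator_span_singleton _ _).mpr (by
      rw [sub_smul, one_smul, hrb, sub_self]))
    simpa using m.add_mem this hr
  have := m.finite_quotient_pow_of_isMaximal (K := K) k
  let e := Module.finBasis K (C ⧸ m ^ k)
  refine ⟨_, (Algebra.leftMulMatrix e).comp (Ideal.Quotient.mkₐ K (m ^ k)), fun h ↦ hk ?_⟩
  rw [← Ideal.Quotient.eq_zero_iff_mem]
  exact Algebra.leftMulMatrix_injective e (by simpa using h)

/-- The matrix entries of a finite type algebra generate a finite type algebra. -/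
lemma Algebra.FiniteType.exists_subalgebra_matrix {S B K : Type*} [CommRing S] [CommRing B]
    [Algebra S B] [CommRing K] [Algebra S K] [Algebra.FiniteType S B] {r : ℕ}
    (ψ : B →ₐ[S] Matrix (Fin r) (Fin r) K) :
    ∃ T : Subalgebra S K, T.FG ∧ ∀ x i j, ψ x i j ∈ T := by
  obtain ⟨s, hs⟩ := Algebra.FiniteType.out (R := S) (A := B)
  let E : Set K := ⋃ x ∈ s, Set.range fun ij : Fin r × Fin r ↦ ψ x ij.1 ij.2
  have hE : E.Finite := s.finite_toSet.biUnion fun x _ ↦ Set.finite_range _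
  let T := Algebra.adjoin S E
  refine ⟨T, Subalgebra.fg_def.mpr ⟨E, hE, rfl⟩, fun x i j ↦ ?_⟩
  have : x ∈ (T.val.mapMatrix (m := Fin r)).range.comap ψ := by
    refine (hs.ge.trans (Algebra.adjoin_le fun y hy ↦ ?_)) (Algebra.mem_top (x := x))
    have hT (i j) : ψ y i j ∈ T := Algebra.subset_adjoin
      (Set.mem_biUnion hy ⟨(i, j), rfl⟩)
    exact ⟨.of fun i j ↦ ⟨ψ y i j, hT i j⟩, rfl⟩
  obtain ⟨N, hN⟩ := this
  have hN' : ψ x i j = N i j := congr($hN.symm i j)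
  exact hN' ▸ (N i j).2

end Matrices

section Locus

variable {S : Type u} [CommRing S] [IsNoetherianRing S]

lemma PrimeSpectrum.exists_isConstructible_of_subalgebra (q : PrimeSpectrum S)
    {T : Subalgebra S q.asIdeal.ResidueField} (hT : T.FG) {c : T} (hc : c ≠ 0) :
    ∃ W, Topology.IsConstructible W ∧ q ∈ W ∧
      ∀ x ∈ W, ∃ p : PrimeSpectrum T, c ∉ p.asIdeal ∧ p.comap (algebraMap S T) = x := by
  have : Algebra.FiniteType S T := T.fg_iff_finiteType.mp hT
  have : Algebra.FinitePresentation S T := Algebra.FinitePresentation.of_finiteType.mp this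
  refine ⟨comap (algebraMap S T) '' basicOpen c,
    isConstructible_comap_image (RingHom.finitePresentation_algebraMap.mpr this)
      isConstructible_basicOpen, ⟨⟨⊥, Ideal.isPrime_bot⟩, by simpa using hc, ?_⟩,
    fun x ⟨p, hp, hpx⟩ ↦ ⟨p, hp, hpx⟩⟩
  ext x
  rw [← Ideal.algebraMap_residueField_eq_zero (I := q.asIdeal)]
  simp [Ideal.mem_comap, Subtype.ext_iff]

/-- The locus where a section of a finite type algebra vanishes on the fiber is constructible. -/
theorem PrimeSpectrum.isConstructible_setOf_tmul_one_eq_zero {B : Type*} [CommRing B]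
    [Algebra S B] [Algebra.FiniteType S B] (b : B) :
    Topology.IsConstructible
      {q : PrimeSpectrum S | b ⊗ₜ[S] (1 : q.asIdeal.ResidueField) = 0} := by
  refine isConstructible_of_forall_exists fun q ↦ ?_
  by_cases hq : b ⊗ₜ[S] (1 : q.asIdeal.ResidueField) = 0
  · obtain ⟨T, _, hT, hb⟩ := TensorProduct.Algebra.eq_of_fg_of_subtype_eq
      (A := (⊥ : Subalgebra S q.asIdeal.ResidueField)) (N := B) Subalgebra.fg_bot
      (t := 1 ⊗ₜ b) (t' := 0) (by simpa using congr(TensorProduct.comm S _ _ $hq))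
    obtain ⟨W, hW, hqW, h⟩ := exists_isConstructible_of_subalgebra q hT one_ne_zero
    refine ⟨W, hW, hqW, fun _ x hx ↦ ?_, fun h ↦ absurd hq h⟩
    obtain ⟨p, -, rfl⟩ := h x hx
    exact tmul_one_residueField_eq_zero (by simpa using hb) p
  · obtain ⟨r, ψ, hψ⟩ := Algebra.FiniteType.exists_matrix_ne_zero
      (K := q.asIdeal.ResidueField) (C := q.asIdeal.ResidueField ⊗[S] B) (b := 1 ⊗ₜ b)
      fun h ↦ hq (by simpa using congr(TensorProduct.comm S _ _ $h))
    obtain ⟨T, hT, hmem⟩ := Algebra.FiniteType.exists_subalgebra_matrix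
      ((ψ.restrictScalars S).comp (Algebra.TensorProduct.includeRight (R := S)))
    obtain ⟨i, j, hij⟩ : ∃ i j, ψ (1 ⊗ₜ b) i j ≠ 0 := by
      by_contra! h
      exact hψ (Matrix.ext h)
    let φ : B →ₗ[S] T := LinearMap.codRestrict (Subalgebra.toSubmodule T)
      (Matrix.entryLinearMap S _ i j ∘ₗ ((ψ.restrictScalars S).comp
        (Algebra.TensorProduct.includeRight (R := S))).toLinearMap) fun x ↦ hmem x i j
    obtain ⟨W, hW, hqW, h⟩ := exists_isConstructible_of_subalgebra q hT (c := φ b)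
      fun h ↦ hij congr(($h : q.asIdeal.ResidueField))
    refine ⟨W, hW, hqW, fun h ↦ absurd h hq, fun _ x hx ↦ ?_⟩
    obtain ⟨p, hp, rfl⟩ := h x hx
    exact tmul_one_residueField_ne_zero φ hp

end Locus

section Fiber

variable {R A t}

lemma tmul_one_mem_nonZeroDivisors_of_flat (ht : t ∈ nonZeroDivisors A)
    [Module.Flat R (A ⧸ Ideal.span {t})] (N : Type*) [CommRing N] [Algebra R N] :
    t ⊗ₜ[R] (1 : N) ∈ nonZeroDivisors (A ⊗[R] N) := by
  have hinj := LinearMap.lTensor_injective_of_exact_of_flat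
    (Ideal.Quotient.mkₐ R (Ideal.span {t})).toLinearMap Ideal.Quotient.mk_surjective
    (LinearMap.mulLeft R t) (fun x y h ↦ (mul_cancel_left_mem_nonZeroDivisors ht).mp h)
    (fun x ↦ by
      simp [Ideal.Quotient.eq_zero_iff_mem, Ideal.mem_span_singleton, dvd_def,
        eq_comm (b := x)]) N
  rw [LinearMap.lTensor_inj_iff_rTensor_inj] at hinj
  refine mem_nonZeroDivisors_iff_right.mpr fun x hx ↦ hinj ?_
  have : (LinearMap.mulLeft R t).rTensor N = LinearMap.mulLeft R (t ⊗ₜ[R] (1 : N)) := by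
    ext
    simp
  rw [this, map_zero, LinearMap.mulLeft_apply, mul_comm, hx]

lemma tmul_one_eq_zero_iff_dvd (s b : A) (N : Type*) [CommRing N] [Algebra R N] :
    (Ideal.Quotient.mk (Ideal.span {s}) b) ⊗ₜ[R] (1 : N) = 0 ↔
      s ⊗ₜ[R] (1 : N) ∣ b ⊗ₜ[R] (1 : N) := by
  have h := Algebra.TensorProduct.rTensor_ker (R := R) (C := N)
    (f := Ideal.Quotient.mkₐ R (Ideal.span {s})) Ideal.Quotient.mk_surjective
  have hker : RingHom.ker (Ideal.Quotient.mkₐ R (Ideal.span {s})) = Ideal.span {s} :=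
    Ideal.mk_ker
  rw [hker, Ideal.map_span, Set.image_singleton] at h
  simpa [Ideal.mem_span_singleton] using SetLike.ext_iff.mp h (b ⊗ₜ[R] (1 : N))

lemma isLocalization_fiberRingAway (q : PrimeSpectrum R) :
    @IsLocalization.Away _ _ (t ⊗ₜ[R] (1 : residueFieldAt R q)) (fiberRingAway R A t q) _
      (fiberMap R A t q).toAlgebra := by
  let _ := (fiberMap R A t q).toAlgebra
  have : IsScalarTower A (fiberRing R A q) (fiberRingAway R A t q) :=
    .of_algebraMap_eq fun x ↦ by simp [RingHom.algebraMap_toAlgebra, fiberMap]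
  have hpow : .powers (t ⊗ₜ[R] (1 : residueFieldAt R q)) =
    Algebra.algebraMapSubmonoid (fiberRing R A q) (.powers t) := by simp
  rw [IsLocalization.Away, hpow]
  refine IsLocalization.tensorProduct_tensorProduct _ _ _ _ ?_
  ext
  simp [RingHom.algebraMap_toAlgebra, fiberMap]

lemma mem_polLE_iff_dvd (ht : t ∈ nonZeroDivisors A) [Module.Flat R (A ⧸ Ideal.span {t})]
    {g : Localization.Away t} {n m : ℕ} {b : A}
    (hb : algebraMap A (Localization.Away t) t ^ n * g * algebraMap A _ t ^ m =
      algebraMap A _ b) (q : PrimeSpectrum R) :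
    q ∈ polLE R A t g n ↔
      (t ^ m) ⊗ₜ[R] (1 : residueFieldAt R q) ∣ b ⊗ₜ[R] (1 : residueFieldAt R q) := by
  let _ := (fiberMap R A t q).toAlgebra
  have hloc := isLocalization_fiberRingAway (A := A) (t := t) q
  set τ : fiberRing R A q := t ⊗ₜ[R] 1 with hτ
  have hτm : (t ^ m) ⊗ₜ[R] (1 : residueFieldAt R q) = τ ^ m := by simp [hτ]
  have hinj : Function.Injective (fiberMap R A t q) :=
    IsLocalization.injective (fiberRingAway R A t q) (M := .powers τ)
      (Submonoid.powers_le.mpr (tmul_one_mem_nonZeroDivisors_of_flat ht _))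
  have hunit : IsUnit (fiberMap R A t q (τ ^ m)) := by
    rw [map_pow]
    exact (IsLocalization.Away.algebraMap_isUnit (S := fiberRingAway R A t q) τ).pow m
  have key (a u : fiberRing R A q) :
      fiberMap R A t q u * ((algebraMap A (Localization.Away t) t ^ n * g) ⊗ₜ[R] 1) =
        fiberMap R A t q a ↔ u * b ⊗ₜ[R] 1 = τ ^ m * a := by
    have hbm : ((algebraMap A (Localization.Away t) t ^ n * g) ⊗ₜ[R]
        (1 : residueFieldAt R q)) * fiberMap R A t q (τ ^ m) = fiberMap R A t q (b ⊗ₜ[R] 1) := by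
      simp [hτ, fiberMap, ← hb]
    rw [← hunit.mul_left_inj, mul_assoc, hbm, ← map_mul, ← map_mul, hinj.eq_iff, mul_comm a]
  simp only [polLE, Set.mem_ofPred_eq, key, hτm]
  refine ⟨fun h ↦ ?_, fun ⟨c, hc⟩ P _ ↦ ⟨c, 1, P.asIdeal.one_notMem, by rw [one_mul, hc]⟩⟩
  let J : Ideal (fiberRing R A q) :=
    Submodule.comap (LinearMap.toSpanSingleton _ _ (b ⊗ₜ[R] 1)) (Ideal.span {τ ^ m})
  have hJ (u : fiberRing R A q) : u ∈ J ↔ τ ^ m ∣ u * b ⊗ₜ[R] 1 := Ideal.mem_span_singleton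
  suffices J = ⊤ by simpa [hJ] using J.eq_top_iff_one.mp this
  by_contra hne
  obtain ⟨P, hP, hJP⟩ := J.exists_le_maximal hne
  have hτP : τ ∈ P := hP.isPrime.mem_of_pow_mem m (hJP ((hJ _).mpr (dvd_mul_right _ _)))
  obtain ⟨a, u, hu, hau⟩ := h ⟨P, hP.isPrime⟩ hτP
  exact hu (hJP ((hJ u).mpr ⟨a, hau⟩))

end Fiber

/-- Let `S = Spec R` be noetherian, `X = Spec A` a smooth affine `S`-scheme of
finite type, `t ∈ A` a regular element such that `D = V(t)` is irreducible and
smooth over `S`, and `U = Spec A[t⁻¹]`.  For `g ∈ A[t⁻¹]` and `n ≥ 0`, the set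
`Pol_{≤n}(g)` of points `s ∈ S` such that `g|_{U_s}` has pole order at most `n`
along the divisor `D_s ⊆ X_s` is a constructible subset of `S`. -/
theorem polLE_constructible
    [IsNoetherianRing R] [Algebra.Smooth R A]
    (ht : t ∈ nonZeroDivisors A)
    (hDirr : IsIrreducible (PrimeSpectrum.zeroLocus ({t} : Set A)))
    (hDsmooth : Algebra.Smooth R (A ⧸ Ideal.span {t}))
    (g : Localization.Away t) (n : ℕ) :
    IsConstructibleSet (polLE R A t g n) := by
  obtain ⟨m, b, hb⟩ := IsLocalization.Away.surj t (algebraMap A (Localization.Away t) t ^ n * g)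
  have hpol : polLE R A t g n = {q : PrimeSpectrum R |
      Ideal.Quotient.mk (Ideal.span {t ^ m}) b ⊗ₜ[R] (1 : q.asIdeal.ResidueField) = 0} := by
    ext q
    exact (mem_polLE_iff_dvd ht hb q).trans (tmul_one_eq_zero_iff_dvd _ _ _).symm
  rw [hpol]
  exact PrimeSpectrum.isConstructibleSet_of_isConstructible
    (PrimeSpectrum.isConstructible_setOf_tmul_one_eq_zero _)

end
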